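/- arXiv:2502.11119 — 2 statements merged into one kernel-verified Lean document; each statement's English description precedes it below -/
import Mathlib

section
/- Vanishing in the remaining degrees (Statement 1.2): Let p be an odd prime and let m be a natural number which satisfies none of the following conditions: (a) 0 ≤ m ≤ p−2; (b) m = ((i+1)p + j + 1)p^s − 2 for some 0 ≤ i ≤ p−1, 0 ≤ j ≤ p−1, s ≥ 0; (c) m = ((i+1)p^r + j + 1)p^s − 2 for some 1 ≤ i ≤ p−1, 0 ≤ j ≤ p−2, r ≥ 2, s ≥ 0; (d) m = (p^2 + ip + j + 1)p^s − 2 for some 1 ≤ i ≤ j ≤ p−2, s ≥ 0. Then every homogeneous polynomial in P_2 = 𝔽_p[x,y] of total degree m is hit; that is, the quotient of the degree-m homogeneous component of P_2 by the hit polynomials is the zero vector space. -/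
open MvPolynomial

/-- The total Steenrod power map `Φ : P_h → P_h[ξ]`, the `𝔽_p`-algebra homomorphism
sending each generator `t_i` to `t_i + t_i^p ξ`. -/
noncomputable def Phi (p h : ℕ) :
    MvPolynomial (Fin h) (ZMod p) →ₐ[ZMod p] Polynomial (MvPolynomial (Fin h) (ZMod p)) :=
  aeval fun i => Polynomial.C (X i) + Polynomial.C (X i ^ p) * Polynomial.X

/-- The Steenrod power operation `𝒫^k : P_h → P_h`: the coefficient of `ξ^k` in `Φ(f)`. -/
noncomputable def steenrodP (p h : ℕ) (k : ℕ) (f : MvPolynomial (Fin h) (ZMod p)) :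
    MvPolynomial (Fin h) (ZMod p) :=
  (Phi p h f).coeff k

/-- The `𝔽_p`-subspace of hit polynomials: the span of `{𝒫^k g : k ≥ 1, g ∈ P_h}`. -/
noncomputable def Hit (p h : ℕ) : Submodule (ZMod p) (MvPolynomial (Fin h) (ZMod p)) :=
  Submodule.span (ZMod p) {g | ∃ k, 1 ≤ k ∧ ∃ u, g = steenrodP p h k u}

section Helpers
open Finset

/-- A function `l` on exponent pairs that kills all hit elements of degree `m`. -/
def HRel (p m : ℕ) (l : ℕ → ℕ → ZMod p) : Prop :=
  ∀ k a b, 1 ≤ k → a + b + k * (p - 1) = m →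
    ∑ x ∈ antidiagonal k, ((a.choose x.1 : ZMod p) * (b.choose x.2 : ZMod p)) *
      l (a + x.1 * (p - 1)) (b + x.2 * (p - 1)) = 0

def Good (p m : ℕ) : Prop := ∀ l, HRel p m l → ∀ a b, a + b = m → l a b = 0

def GoodN (p M n : ℕ) : Prop := ∀ u : ℕ → ℕ → ZMod p,
  (∀ α β, α + β = n → HRel p M (fun i j => u (i + α) (j + β))) →
    ∀ A B, A + B = M + n → u A B = 0

lemma HRel.swap {p m : ℕ} {l : ℕ → ℕ → ZMod p} (h : HRel p m l) : HRel p m (fun a b => l b a) := by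
  intro k a b hk hab
  have := h k b a hk (by omega)
  rw [← this, ← Finset.Nat.sum_antidiagonal_swap]
  refine Finset.sum_congr rfl fun x _ => ?_
  simp only [Prod.fst_swap, Prod.snd_swap]
  ring

lemma HRel.one {p m : ℕ} {l : ℕ → ℕ → ZMod p} (h : HRel p m l) (a b : ℕ)
    (hab : a + b + (p - 1) = m) :
    (a : ZMod p) * l (a + (p - 1)) b + (b : ZMod p) * l a (b + (p - 1)) = 0 := by
  have := h 1 a b le_rfl (by omega)
  rw [Finset.Nat.antidiagonal_succ] at this
  simp at this
  rw [← this]; ring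

lemma cast_ne {p : ℕ} (a : ℕ) (h1 : 1 ≤ a) (h2 : a < p) : (a : ZMod p) ≠ 0 := by
  intro h
  rw [ZMod.natCast_eq_zero_iff] at h
  exact absurd (Nat.le_of_dvd (by omega) h) (by omega)

lemma typeI_aux {p m : ℕ} [Fact p.Prime] {l : ℕ → ℕ → ZMod p} (h : HRel p m l) (c : ℕ) (hc : c + 2 ≤ p) :
    ∀ b a i j, a + b = c → b < i → p * (i + j) + c = m → l (p * i + a) (p * j + b) = 0 := by
  have hp : 2 ≤ p := (Fact.out : p.Prime).two_le
  intro b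
  induction b with
  | zero =>
    intro a i j hab hi hm
    obtain ⟨i, rfl⟩ : ∃ i', i = i' + 1 := ⟨i - 1, by omega⟩
    have e1 : p * i + a + 1 + (p - 1) = p * (i + 1) + a := by rw [mul_add]; omega
    have e2 : p * (i + 1 + j) = p * i + p + p * j := by ring
    have := h.one (p * i + a + 1) (p * j) (by omega)
    rw [e1] at this
    have hne := cast_ne (p := p) (a + 1) (by omega) (by omega)
    push_cast at this hne
    simp only [CharP.cast_eq_zero, zero_mul, zero_add, add_zero, mul_eq_zero] at this
    rcases this with h | h
    · exact absurd h hne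
    · simpa using h
  | succ b ih =>
    intro a i j hab hi hm
    obtain ⟨i, rfl⟩ : ∃ i', i = i' + 1 := ⟨i - 1, by omega⟩
    have e1 : p * i + a + 1 + (p - 1) = p * (i + 1) + a := by rw [mul_add]; omega
    have e3 : p * j + (b + 1) + (p - 1) = p * (j + 1) + b := by rw [mul_add]; omega
    have e2 : p * (i + 1 + j) = p * i + p + p * j := by ring
    have := h.one (p * i + a + 1) (p * j + (b + 1)) (by omega)
    rw [e1, e3, add_assoc (p * i) a 1,
      ih (a + 1) i (j + 1) (by omega) (by omega) (by rw [← hm]; ring)] at this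
    have hne := cast_ne (p := p) (a + 1) (by omega) (by omega)
    push_cast at this hne
    simp only [CharP.cast_eq_zero, zero_mul, zero_add, add_zero, mul_zero, mul_eq_zero] at this
    rcases this with h | h
    · exact absurd h hne
    · simpa using h

lemma typeI {p m : ℕ} [Fact p.Prime] {l : ℕ → ℕ → ZMod p} (h : HRel p m l) (a b i j : ℕ)
    (hc : a + b + 2 ≤ p) (hij : p ≤ i + j) (hm : p * (i + j) + (a + b) = m) :
    l (p * i + a) (p * j + b) = 0 := by
  by_cases hb : b < i
  · exact typeI_aux h (a + b) hc b a i j rfl hb hm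
  · exact typeI_aux h.swap (a + b) hc a b j i (by omega) (by omega) (by rw [← hm]; ring)

/-- normalising coefficient -/
noncomputable def nu (p a b : ℕ) : ZMod p :=
  (-1) ^ a * ((a.factorial : ZMod p) * (b.factorial : ZMod p))⁻¹

lemma fact_ne {p : ℕ} [Fact p.Prime] (a : ℕ) (h : a < p) : (a.factorial : ZMod p) ≠ 0 := by
  intro h0
  rw [ZMod.natCast_eq_zero_iff, (Fact.out : p.Prime).dvd_factorial] at h0
  omega

lemma nu_ne {p : ℕ} [Fact p.Prime] (a b : ℕ) (ha : a < p) (hb : b < p) : nu p a b ≠ 0 := by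
  unfold nu
  exact mul_ne_zero (pow_ne_zero _ (by simp)) (inv_ne_zero (mul_ne_zero (fact_ne a ha) (fact_ne b hb)))

lemma nu_step {p : ℕ} [Fact p.Prime] (a b : ℕ) (ha : a + 1 < p) (hb : b + 1 < p) (x y : ZMod p)
    (h : (a + 1 : ZMod p) * x + (b + 1) * y = 0) :
    nu p a (b + 1) * x = nu p (a + 1) b * y := by
  unfold nu
  have h1 := fact_ne (p := p) (a + 1) ha
  have h2 := fact_ne (p := p) (b + 1) hb
  rw [Nat.factorial_succ] at h1 h2 ⊢
  rw [Nat.factorial_succ]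
  push_cast at h1 h2 ⊢
  have h3 := left_ne_zero_of_mul h1
  have h4 := right_ne_zero_of_mul h1
  have h5 := left_ne_zero_of_mul h2
  have h6 := right_ne_zero_of_mul h2
  field_simp
  rw [pow_succ]
  linear_combination (-1) ^ a * h

/-- the value at `X^i Y^j x^(α+q) y^(β+q)` -/
noncomputable def gg (p q : ℕ) (l : ℕ → ℕ → ZMod p) (i α j β : ℕ) : ZMod p :=
  nu p (α + q) (β + q) * l (p * i + (α + q)) (p * j + (β + q))

noncomputable def mu (p q n : ℕ) (l : ℕ → ℕ → ZMod p) (A B : ℕ) : ZMod p :=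
  gg p q l (A - min A n) (min A n) (B - (n - min A n)) (n - min A n)

lemma gg_step {p m q n M : ℕ} [Fact p.Prime] {l : ℕ → ℕ → ZMod p} (h : HRel p m l)
    (hq : q + n + 1 = p) (hm : p * M + n + 2 * q = m) (i j α β : ℕ) (hn : α + β + 1 = n)
    (hij : i + 1 + j = M) :
    gg p q l (i + 1) α j (β + 1) = gg p q l i (α + 1) (j + 1) β := by
  unfold gg
  have hp : 2 ≤ p := (Fact.out : p.Prime).two_le
  have e0 : β + 1 + q = β + q + 1 := by omega
  have e0' : α + 1 + q = α + q + 1 := by omega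
  rw [e0, e0']
  apply nu_step _ _ (by omega) (by omega)
  have e2 : p * M = p * i + p + p * j := by rw [← hij]; ring
  have := h.one (p * i + (α + q + 1)) (p * j + (β + q + 1)) (by omega)
  have e1 : p * i + (α + q + 1) + (p - 1) = p * (i + 1) + (α + q) := by rw [mul_add]; omega
  have e3 : p * j + (β + q + 1) + (p - 1) = p * (j + 1) + (β + q) := by rw [mul_add]; omega
  rw [e1, e3] at this
  push_cast at this ⊢
  simpa using this

lemma mu_eq {p m q n M : ℕ} [Fact p.Prime] {l : ℕ → ℕ → ZMod p} (h : HRel p m l)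
    (hq : q + n + 1 = p) (hm : p * M + n + 2 * q = m) :
    ∀ β α i j, α + β = n → i + j = M → mu p q n l (i + α) (j + β) = gg p q l i α j β := by
  intro β
  induction β with
  | zero =>
    intro α i j hn hij
    unfold mu
    have : min (i + α) n = α := by omega
    rw [this]
    have e : n - α = 0 := by omega
    simp [e]
  | succ β ih =>
    intro α i j hn hij
    rcases i with _ | i
    · unfold mu
      have : min (0 + α) n = α := by omega
      rw [this]
      have e : n - α = β + 1 := by omega
      simp [e]
    · rw [gg_step h hq hm i j α β (by omega) hij, ← ih (α + 1) i (j + 1) (by omega) (by omega)]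
      congr 1 <;> omega

lemma choose_lucas {p : ℕ} [Fact p.Prime] (i a s : ℕ) (ha : a < p) :
    (((p * i + a).choose s : ℕ) : ZMod p) = (a.choose (s % p) : ZMod p) * (i.choose (s / p) : ZMod p) := by
  have h := Choose.choose_modEq_choose_mod_mul_choose_div_nat (n := p * i + a) (k := s) (p := p)
  have hp : 0 < p := (Fact.out : p.Prime).pos
  have h1 : (p * i + a) % p = a := by rw [Nat.mul_add_mod, Nat.mod_eq_of_lt ha]
  have h2 : (p * i + a) / p = i := by
    rw [Nat.mul_add_div hp, Nat.div_eq_of_lt ha, add_zero]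
  rw [h1, h2] at h
  have := (ZMod.natCast_eq_natCast_iff _ _ _).2 h
  rw [this]; push_cast; ring

lemma mu_rel {p m q n M : ℕ} [Fact p.Prime] {l : ℕ → ℕ → ZMod p} (h : HRel p m l)
    (hq : q + n + 1 = p) (hm : p * M + n + 2 * q = m) (hM : p ≤ M) (α β : ℕ) (hn : α + β = n) :
    HRel p M (fun i j => mu p q n l (i + α) (j + β)) := by
  intro k i j hk hij
  have hp : 2 ≤ p := (Fact.out : p.Prime).two_le
  have hpos : 0 < p := by omega
  have main := h (p * k) (p * i + (α + q)) (p * j + (β + q)) (by nlinarith) (by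
    rw [← hm, ← hij]
    have : p * (i + j + k * (p - 1)) = p * i + p * j + p * k * (p - 1) := by ring
    omega)
  have hinj : Set.InjOn (fun x : ℕ × ℕ => (p * x.1, p * x.2)) (antidiagonal k : Finset (ℕ × ℕ)) := by
    intro x _ y _ hxy
    simp only [Prod.mk.injEq] at hxy
    exact Prod.ext (Nat.eq_of_mul_eq_mul_left hpos hxy.1) (Nat.eq_of_mul_eq_mul_left hpos hxy.2)
  let S : Finset (ℕ × ℕ) := (antidiagonal k).image (fun x : ℕ × ℕ => (p * x.1, p * x.2))
  have hS : S ⊆ antidiagonal (p * k) := by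
    intro x hx
    simp only [S, Finset.mem_image, Finset.HasAntidiagonal.mem_antidiagonal] at hx
    obtain ⟨y, hy, rfl⟩ := hx
    simp only [Finset.HasAntidiagonal.mem_antidiagonal]
    rw [← hy]; ring
  rw [← Finset.sum_subset hS, Finset.sum_image hinj] at main
  · have := congrArg (fun z => nu p (α + q) (β + q) * z) main
    simp only [mul_zero] at this
    rw [← this, Finset.mul_sum]
    refine Finset.sum_congr rfl fun x hx => ?_
    rw [Finset.HasAntidiagonal.mem_antidiagonal] at hx
    have e1 : i + j + k * (p - 1) = (i + x.1 * (p - 1)) + (j + x.2 * (p - 1)) := by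
      rw [← hx]; ring
    simp only
    rw [mu_eq h hq hm β α _ _ hn (by omega)]
    simp only [gg]
    rw [choose_lucas _ _ _ (by omega), choose_lucas _ _ _ (by omega)]
    have e2 : p * (i + x.1 * (p - 1)) + (α + q) = p * i + (α + q) + p * x.1 * (p - 1) := by ring
    have e3 : p * (j + x.2 * (p - 1)) + (β + q) = p * j + (β + q) + p * x.2 * (p - 1) := by ring
    rw [e2, e3]
    simp [Nat.mul_div_cancel_left _ hpos]
    ring
  · rintro ⟨s, t⟩ hx hxS
    rw [Finset.HasAntidiagonal.mem_antidiagonal] at hx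
    simp only at hx ⊢
    rw [choose_lucas _ _ _ (by omega), choose_lucas _ _ _ (by omega)]
    have hs := Nat.div_add_mod s p
    have ht := Nat.div_add_mod t p
    have hs' := Nat.mod_lt s hpos
    have ht' := Nat.mod_lt t hpos
    generalize s % p = σ at *
    generalize t % p = τ at *
    generalize s / p = s' at *
    generalize t / p = t' at *
    subst hs ht
    have hdvd : p ∣ σ + τ := by
      have h1 : p ∣ p * (s' + t') + (σ + τ) := ⟨k, by rw [← hx]; ring⟩
      exact (Nat.dvd_add_right (dvd_mul_right _ _)).1 h1
    obtain ⟨w, hw⟩ := hdvd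
    have hw2 : w < 2 := by
      by_contra hcon
      have : p * 2 ≤ p * w := Nat.mul_le_mul_left _ (by omega)
      omega
    have hw3 : w = 1 := by
      by_contra hcon
      have : w = 0 := by omega
      subst this
      have h1 : σ = 0 := by omega
      have h2 : τ = 0 := by omega
      subst h1 h2
      apply hxS
      simp only [S, Finset.mem_image, Finset.HasAntidiagonal.mem_antidiagonal]
      refine ⟨(s', t'), ?_, by simp⟩
      apply Nat.eq_of_mul_eq_mul_left hpos
      rw [← hx]; simp; ring
    subst hw3
    by_cases c1 : α + q < σ
    · simp [Nat.choose_eq_zero_of_lt c1]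
    by_cases c2 : β + q < τ
    · simp [Nat.choose_eq_zero_of_lt c2]
    obtain ⟨r, hr⟩ : ∃ r, p = r + 1 := ⟨p - 1, by omega⟩
    obtain ⟨a, ha⟩ : ∃ a, α + q = a + σ := ⟨α + q - σ, by omega⟩
    obtain ⟨b, hb⟩ : ∃ b, β + q = b + τ := ⟨β + q - τ, by omega⟩
    have e1 : p * i + (α + q) + (p * s' + σ) * (p - 1) = p * (i + s' * (p - 1) + σ) + a := by
      rw [ha, hr]; simp; ring
    have e2 : p * j + (β + q) + (p * t' + τ) * (p - 1) = p * (j + t' * (p - 1) + τ) + b := by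
      rw [hb, hr]; simp; ring
    have e3 : s' + t' + 1 = k := by
      apply Nat.eq_of_mul_eq_mul_left hpos
      rw [← hx]
      have : p * (s' + t' + 1) = p * s' + p * t' + p := by ring
      omega
    have e4 : i + s' * (p - 1) + σ + (j + t' * (p - 1) + τ) = M + 1 := by
      rw [← hij, ← e3]
      have : (s' + t' + 1) * (p - 1) = s' * (p - 1) + t' * (p - 1) + (p - 1) := by ring
      omega
    rw [e1, e2, typeI h a b _ _ (by omega) (by omega) (by
      rw [e4, ← hm, mul_add]; omega), mul_zero]

lemma key {p m q n M : ℕ} [Fact p.Prime] (hq : q + n + 1 = p) (hm : p * M + n + 2 * q = m)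
    (hM : p ≤ M) (hg : GoodN p M n) : Good p m := by
  intro l h a' b' hab
  have hpos : 0 < p := (Fact.out : p.Prime).pos
  have hs := Nat.div_add_mod a' p
  have ht := Nat.div_add_mod b' p
  have hs' := Nat.mod_lt a' hpos
  have ht' := Nat.mod_lt b' hpos
  generalize a' % p = a at *
  generalize b' % p = b at *
  generalize a' / p = i at *
  generalize b' / p = j at *
  subst hs ht
  have e0 : p * (i + j) = p * i + p * j := by ring
  have hlow : i + j < M + 2 := by
    by_contra hcon
    have : p * (M + 2) ≤ p * (i + j) := Nat.mul_le_mul_left _ (by omega)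
    rw [mul_add] at this
    omega
  have hhigh : M ≤ i + j := by
    by_contra hcon
    have : p * (i + j + 1) ≤ p * M := Nat.mul_le_mul_left _ (by omega)
    rw [mul_add] at this
    omega
  rcases Nat.lt_or_ge M (i + j) with hc | hc
  · have e : i + j = M + 1 := by omega
    rw [e, mul_add] at e0
    exact typeI h a b i j (by omega) (by omega) (by rw [e, mul_add]; omega)
  · have e : i + j = M := by omega
    rw [e] at e0
    have := hg (mu p q n l) (fun α β hn => mu_rel h hq hm hM α β hn)
      (i + (a - q)) (j + (b - q)) (by omega)
    rw [mu_eq h hq hm _ _ _ _ (by omega) e] at this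
    unfold gg at this
    have e1 : a - q + q = a := by omega
    have e2 : b - q + q = b := by omega
    rw [e1, e2] at this
    exact (mul_eq_zero.1 this).resolve_left (nu_ne a b hs' ht')

lemma goodN_zero {p M : ℕ} (h : Good p M) : GoodN p M 0 := by
  intro u hu A B hAB
  exact h u (by simpa using hu 0 0 rfl) A B (by omega)

lemma goodN_succ {p M n : ℕ} (hM : 1 ≤ M) (h : GoodN p M n) : GoodN p M (n + 1) := by
  intro u hu A B hAB
  rcases A with _ | A
  · obtain ⟨B, rfl⟩ : ∃ B', B = B' + 1 := ⟨B - 1, by omega⟩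
    exact h (fun a b => u a (b + 1)) (fun α β hab => hu α (β + 1) (by omega)) 0 B (by omega)
  · exact h (fun a b => u (a + 1) b) (fun α β hab => by
      have := hu (α + 1) β (by omega)
      exact this) A B (by omega)

lemma goodN_mono {p M n : ℕ} (hM : 1 ≤ M) (h : GoodN p M n) (k : ℕ) : GoodN p M (n + k) := by
  induction k with
  | zero => exact h
  | succ k ih => exact goodN_succ hM ih

lemma goodN_one {p M : ℕ} [Fact p.Prime] (hL : ((M + 1 : ℕ) : ZMod p) ≠ 0) (h2 : 2 * p ≤ M + 1) :
    GoodN p M 1 := by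
  intro u hu
  have hp : 2 ≤ p := (Fact.out : p.Prime).two_le
  have h10 := hu 1 0 rfl
  have h01 := hu 0 1 rfl
  have key1 : ∀ a b, a + b + p = M → u (a + p) (b + 1) = 0 ∧ u (a + 1) (b + p) = 0 := by
    intro a b hab
    have r1 := h10.one a (b + 1) (by omega)
    have r2 := h01.one (a + 1) b (by omega)
    have e1 : a + (p - 1) + 1 = a + p := by omega
    have e2 : b + 1 + (p - 1) + 0 = b + p := by omega
    have e3 : a + 1 + (p - 1) + 0 = a + p := by omega
    have e4 : b + (p - 1) + 1 = b + p := by omega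
    rw [e1, e2] at r1
    rw [e3, e4] at r2
    rw [← hab] at hL
    push_cast at hL r1 r2
    rw [CharP.cast_eq_zero (ZMod p) p, add_zero] at hL
    simp only [add_zero] at r1 r2
    constructor
    · apply (mul_eq_zero.1 (_ : ((a : ZMod p) + b + 1) * _ = 0)).resolve_left hL
      linear_combination (-(b : ZMod p)) * r1 + (b + 1 : ZMod p) * r2
    · apply (mul_eq_zero.1 (_ : ((a : ZMod p) + b + 1) * _ = 0)).resolve_left hL
      linear_combination (a + 1 : ZMod p) * r1 - (a : ZMod p) * r2
  have hLp : ((M + 1 - p : ℕ) : ZMod p) ≠ 0 := by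
    rw [Nat.cast_sub (by omega)]; simpa using hL
  intro A B hAB
  rcases Nat.eq_zero_or_pos B with rfl | hB
  · have r := h10.one (M + 1 - p) 0 (by omega)
    simp only [Nat.cast_zero, zero_mul, add_zero] at r
    have e : M + 1 - p + (p - 1) + 1 = A := by omega
    rw [e] at r
    exact (mul_eq_zero.1 r).resolve_left hLp
  rcases Nat.eq_zero_or_pos A with rfl | hA
  · have r := h01.one 0 (M + 1 - p) (by omega)
    simp only [Nat.cast_zero, zero_mul, zero_add] at r
    have e : M + 1 - p + (p - 1) + 1 = B := by omega
    rw [e] at r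
    exact (mul_eq_zero.1 r).resolve_left hLp
  by_cases hAp : p ≤ A
  · have := (key1 (A - p) (B - 1) (by omega)).1
    rwa [Nat.sub_add_cancel hAp, Nat.sub_add_cancel hB] at this
  · have := (key1 (A - 1) (B - p) (by omega)).2
    rwa [Nat.sub_add_cancel hA, Nat.sub_add_cancel (by omega)] at this

lemma goodN_one' {p M k e : ℕ} [Fact p.Prime] (hL : ((M + 1 : ℕ) : ZMod p) = 0)
    (hk : 1 ≤ k) (he : p - 1 ≤ e) (hke : e + k * (p - 1) = M)
    (hch : ((e.choose k : ℕ) : ZMod p) ≠ 0) : GoodN p M 1 := by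
  intro u hu
  have hp : 2 ≤ p := (Fact.out : p.Prime).two_le
  have h10 := hu 1 0 rfl
  have h01 := hu 0 1 rfl
  have key1 : ∀ a b, a + b + p = M → u (a + p) (b + 1) = u (a + 1) (b + p) := by
    intro a b hab
    have r1 := h10.one a (b + 1) (by omega)
    have r2 := h01.one (a + 1) b (by omega)
    have e1 : a + (p - 1) + 1 = a + p := by omega
    have e2 : b + 1 + (p - 1) + 0 = b + p := by omega
    have e3 : a + 1 + (p - 1) + 0 = a + p := by omega
    have e4 : b + (p - 1) + 1 = b + p := by omega
    rw [e1, e2] at r1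
    rw [e3, e4] at r2
    rw [← hab] at hL
    push_cast at hL r1 r2
    rw [CharP.cast_eq_zero (ZMod p) p, add_zero] at hL
    simp only [add_zero] at r1 r2
    linear_combination r2 - r1 + (u (a+1) (b+p) - u (a+1) (b+p)) * hL
  have key2 : ∀ t a b, 1 ≤ a → 1 ≤ b → a + b + t * (p - 1) = M + 1 →
      u (a + t * (p - 1)) b = u a (b + t * (p - 1)) := by
    intro t
    induction t with
    | zero => intro a b _ _ _; simp
    | succ t ih =>
      intro a b ha hb hab
      have e0 : (t + 1) * (p - 1) = t * (p - 1) + (p - 1) := by ring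
      rw [e0] at hab ⊢
      have := key1 (a - 1 + t * (p - 1)) (b - 1) (by omega)
      have e1 : a - 1 + t * (p - 1) + p = a + (t * (p - 1) + (p - 1)) := by omega
      have e2 : b - 1 + 1 = b := by omega
      have e3 : a - 1 + t * (p - 1) + 1 = a + t * (p - 1) := by omega
      have e4 : b - 1 + p = b + (p - 1) := by omega
      rw [e1, e2, e3, e4] at this
      rw [this, ih a (b + (p - 1)) ha (by omega) (by omega)]
      congr 1; omega
  have key3 : ∀ a b, 1 ≤ b → a + b = e → u (a + 1) (b + k * (p - 1)) = 0 := by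
    intro a b hb hab
    have r := h10 k a b hk (by omega)
    have : ∀ x ∈ antidiagonal k, ((a.choose x.1 : ZMod p) * (b.choose x.2 : ZMod p)) *
      u (a + x.1 * (p - 1) + 1) (b + x.2 * (p - 1) + 0) =
      ((a.choose x.1 : ZMod p) * (b.choose x.2 : ZMod p)) * u (a + 1) (b + k * (p - 1)) := by
      intro x hx
      rw [Finset.HasAntidiagonal.mem_antidiagonal] at hx
      have e1 : k * (p - 1) = x.1 * (p - 1) + x.2 * (p - 1) := by rw [← hx]; ring
      have := key2 x.1 (a + 1) (b + x.2 * (p - 1)) (by omega) (by omega) (by omega)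
      have e2 : a + x.1 * (p - 1) + 1 = a + 1 + x.1 * (p - 1) := by omega
      rw [e2, add_zero, this, e1]
      congr 2; omega
    rw [Finset.sum_congr rfl this, ← Finset.sum_mul] at r
    have e3 : ∑ x ∈ antidiagonal k, (a.choose x.1 : ZMod p) * (b.choose x.2 : ZMod p)
        = ((e.choose k : ℕ) : ZMod p) := by
      rw [← hab, Nat.add_choose_eq]; push_cast; rfl
    rw [e3] at r
    exact (mul_eq_zero.1 r).resolve_left hch
  intro A B hAB
  rcases Nat.eq_zero_or_pos B with rfl | hB
  · have r := h10 k e 0 hk (by omega)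
    rw [Finset.sum_eq_single (k, 0)] at r
    · have e1 : e + k * (p - 1) + 1 = A := by omega
      simp only [e1, Nat.choose_self, Nat.cast_one, mul_one, zero_mul, add_zero] at r
      exact (mul_eq_zero.1 r).resolve_left hch
    · rintro ⟨s, t⟩ hx hne
      rw [Finset.HasAntidiagonal.mem_antidiagonal] at hx
      have : 0 < t := by
        rcases Nat.eq_zero_or_pos t with rfl | h
        · simp at hx; subst hx; simp at hne
        · exact h
      simp [Nat.choose_eq_zero_of_lt this]
    · intro h; simp at h
  rcases Nat.eq_zero_or_pos A with rfl | hA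
  · have r := h01 k 0 e hk (by omega)
    rw [Finset.sum_eq_single (0, k)] at r
    · have e1 : e + k * (p - 1) + 1 = B := by omega
      simp only [e1, Nat.choose_self, Nat.cast_one, one_mul, zero_mul, add_zero] at r
      exact (mul_eq_zero.1 r).resolve_left hch
    · rintro ⟨s, t⟩ hx hne
      rw [Finset.HasAntidiagonal.mem_antidiagonal] at hx
      have : 0 < s := by
        rcases Nat.eq_zero_or_pos s with rfl | h
        · simp at hx; subst hx; simp at hne
        · exact h
      simp [Nat.choose_eq_zero_of_lt this]
    · intro h; simp at h
  have hA2 := Nat.mod_add_div (A - 1) (p - 1)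
  have hA3 := Nat.mod_lt (A - 1) (show 0 < p - 1 by omega)
  set a := (A - 1) % (p - 1) with hadef
  set t := (A - 1) / (p - 1) with htdef
  have e1 : A = a + 1 + t * (p - 1) := by rw [mul_comm t]; omega
  have r := key2 t (a + 1) B (by omega) hB (by omega)
  rw [← e1] at r
  rw [r]
  have r3 := key3 a (e - a) (by omega) (by omega)
  convert r3 using 2
  omega

lemma goodN_B {p i : ℕ} [Fact p.Prime] (hi : 1 ≤ i) (hip : i < p) :
    GoodN p (p + i - 1) (p - i) := by
  intro u hu
  have hp : 2 ≤ p := (Fact.out : p.Prime).two_le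
  have rel : ∀ ε a α, a ≤ i → α ≤ p - i → i + α = ε + a →
      ((i : ZMod p) - a) * u (p - 1 + ε) (p - ε) + a * u ε (2 * p - 1 - ε) = 0 := by
    intro ε a α ha hα hε
    have r := (hu α (p - i - α) (by omega)).one (i - a) a (by omega)
    have e1 : i - a + (p - 1) + α = p - 1 + ε := by omega
    have e2 : a + (p - i - α) = p - ε := by omega
    have e3 : i - a + α = ε := by omega
    have e4 : a + (p - 1) + (p - i - α) = 2 * p - 1 - ε := by omega
    rw [e1, e2, e3, e4, Nat.cast_sub ha] at r
    exact r
  have hi0 := cast_ne (p := p) i hi hip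
  have mid : ∀ ε, 1 ≤ ε → ε < p →
      u (p - 1 + ε) (p - ε) = 0 ∧ u ε (2 * p - 1 - ε) = 0 := by
    intro ε h1 h2
    obtain ⟨a, α, ha, hα, hε⟩ : ∃ a α, a + 1 ≤ i ∧ α + 1 ≤ p - i ∧ i + α + 1 = ε + (a + 1) := by
      by_cases h : ε ≤ i
      · exact ⟨i - ε, 0, by omega, by omega, by omega⟩
      · exact ⟨0, ε - i, by omega, by omega, by omega⟩
    have r1 := rel ε a α (by omega) (by omega) (by omega)
    have r2 := rel ε (a + 1) (α + 1) (by omega) (by omega) (by omega)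
    push_cast at r2
    constructor
    · apply (mul_eq_zero.1 (_ : (i : ZMod p) * _ = 0)).resolve_left hi0
      linear_combination (a + 1 : ZMod p) * r1 - (a : ZMod p) * r2
    · apply (mul_eq_zero.1 (_ : (i : ZMod p) * _ = 0)).resolve_left hi0
      linear_combination ((i : ZMod p) - a) * r2 - ((i : ZMod p) - a - 1) * r1
  intro A B hAB
  rcases Nat.eq_zero_or_pos A with rfl | hA
  · have r := rel 0 i 0 le_rfl (by omega) (by omega)
    rw [sub_self, zero_mul, zero_add] at r
    have e : 2 * p - 1 - 0 = B := by omega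
    rw [e] at r
    exact (mul_eq_zero.1 r).resolve_left hi0
  by_cases h1 : A < p
  · have := (mid A hA h1).2
    have e : 2 * p - 1 - A = B := by omega
    rwa [e] at this
  by_cases h2 : A = 2 * p - 1
  · have r := rel p 0 (p - i) (by omega) (by omega) (by omega)
    rw [Nat.cast_zero, sub_zero, zero_mul, add_zero] at r
    have e1 : p - 1 + p = A := by omega
    have e2 : p - p = B := by omega
    rw [e1, e2] at r
    exact (mul_eq_zero.1 r).resolve_left hi0
  · have := (mid (A - (p - 1)) (by omega) (by omega)).1
    have e1 : p - 1 + (A - (p - 1)) = A := by omega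
    have e2 : p - (A - (p - 1)) = B := by omega
    rwa [e1, e2] at this

/-- the case where `L = p^t (c + p h)`, `t ≥ 1` -/
lemma goodN_C {p M t c h : ℕ} [Fact p.Prime] (ht : 1 ≤ t) (hc : 1 ≤ c) (hcp : c < p)
    (hL : M + 1 = p ^ t * (c + p * (h + 1))) : GoodN p M 1 := by
  have hp : 2 ≤ p := (Fact.out : p.Prime).two_le
  have hpt : p ≤ p ^ t := Nat.le_self_pow (by omega) p
  have h1 : 1 ≤ p ^ t := by omega
  have hpc : p ^ t * 1 ≤ p ^ t * (c + p * h) := Nat.mul_le_mul_left _ (by omega)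
  refine goodN_one' (k := p ^ t) (e := p ^ t * (c + p * h) + (p ^ t - 1)) ?_ h1 (by omega) ?_ ?_
  · rw [hL]; push_cast; simp [show t ≠ 0 by omega]
  · have e1 : p ^ t * (c + p * (h + 1)) = p ^ t * (c + p * h) + p ^ t * p := by ring
    have e2 : p ^ t * p = p ^ t * (p - 1) + p ^ t := by
      obtain ⟨r, rfl⟩ : ∃ r, p = r + 1 := ⟨p - 1, by omega⟩
      simp; ring
    omega
  · clear hL ht hpt
    have : ∀ (t : ℕ), (((p ^ t * (c + p * h) + (p ^ t - 1)).choose (p ^ t) : ℕ) : ZMod p) = c := by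
      intro t
      induction t with
      | zero => simp
      | succ t ih =>
        have hq : 1 ≤ p ^ t := Nat.one_le_pow _ _ (by omega)
        have e : p ^ (t + 1) * (c + p * h) + (p ^ (t + 1) - 1)
          = p * (p ^ t * (c + p * h) + (p ^ t - 1)) + (p - 1) := by
          obtain ⟨r, hr⟩ : ∃ r, p ^ t = r + 1 := ⟨p ^ t - 1, by omega⟩
          obtain ⟨r', hr'⟩ : ∃ r, p = r + 1 := ⟨p - 1, by omega⟩
          have e1 : p ^ (t + 1) - 1 = p * (p ^ t - 1) + (p - 1) := by
            rw [pow_succ, hr, Nat.add_sub_cancel]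
            have : (r + 1) * p = p * r + p := by ring
            omega
          rw [e1, pow_succ]; ring
        rw [e, choose_lucas _ _ _ (by omega), pow_succ, Nat.mul_mod_left,
          Nat.mul_div_cancel _ (by omega), ih]
        simp
    rw [this]
    exact cast_ne c hc hcp

/-- Degree families, with `N = m + 2`. -/
def Fam (p N : ℕ) : Prop :=
  N ≤ p ∨ (∃ i j s, i ≤ p - 1 ∧ j ≤ p - 1 ∧ N = ((i + 1) * p + j + 1) * p ^ s) ∨
  (∃ i j r s, 1 ≤ i ∧ i ≤ p - 1 ∧ j ≤ p - 2 ∧ 2 ≤ r ∧ N = ((i + 1) * p ^ r + j + 1) * p ^ s) ∨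
  (∃ i j s, 1 ≤ i ∧ i ≤ j ∧ j ≤ p - 2 ∧ N = (p ^ 2 + i * p + j + 1) * p ^ s)

lemma fam_mul {p N : ℕ} (hp : 2 ≤ p) (h : Fam p N) (hN : p < p * N) : Fam p (p * N) := by
  rcases h with h | ⟨i, j, s, h1, h2, h3⟩ | ⟨i, j, r, s, h1, h2, h3, h4, h5⟩ | ⟨i, j, s, h1, h2, h3, h4⟩
  · right; left
    have : 2 ≤ N := by
      by_contra hcon
      have : p * N ≤ p * 1 := Nat.mul_le_mul_left _ (by omega)
      omega
    obtain ⟨i, rfl⟩ : ∃ i, N = i + 2 := ⟨N - 2, by omega⟩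
    refine ⟨i, p - 1, 0, by omega, le_rfl, ?_⟩
    rw [pow_zero, mul_one, add_assoc, Nat.sub_add_cancel (by omega)]; ring
  · right; left
    exact ⟨i, j, s + 1, h1, h2, by rw [h3]; ring⟩
  · right; right; left
    exact ⟨i, j, r, s + 1, h1, h2, h3, h4, by rw [h5]; ring⟩
  · right; right; right
    exact ⟨i, j, s + 1, h1, h2, h3, by rw [h4]; ring⟩

lemma good_of_not_fam {p : ℕ} [Fact p.Prime] (m : ℕ) : ¬ Fam p (m + 2) → Good p m := by
  have hp : 2 ≤ p := (Fact.out : p.Prime).two_le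
  induction m using Nat.strong_induction_on with
  | _ m ih =>
  intro hF
  have hbig : p ^ 2 + p < m + 2 := by
    by_contra hcon
    apply hF
    by_cases h : m + 2 ≤ p
    · exact Or.inl h
    right; left
    have hd := Nat.div_add_mod (m + 1) p
    have hd' := Nat.mod_lt (m + 1) (show 0 < p by omega)
    have h1 : 1 ≤ (m + 1) / p := by
      rw [Nat.one_le_div_iff (by omega)]; omega
    have h2 : (m + 1) / p ≤ p := by
      by_contra h3
      have : p * (p + 1) ≤ p * ((m + 1) / p) := Nat.mul_le_mul_left _ (by omega)
      have e : p * (p + 1) = p ^ 2 + p := by ring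
      omega
    refine ⟨(m + 1) / p - 1, (m + 1) % p, 0, by omega, by omega, ?_⟩
    rw [Nat.sub_add_cancel h1, pow_zero, mul_one, mul_comm]; omega
  have hd := Nat.div_add_mod (m + 2) p
  have hd' := Nat.mod_lt (m + 2) (show 0 < p by omega)
  set L := (m + 2) / p with hLdef
  set c := (m + 2) % p with hcdef
  have hLp : p < L := by
    by_contra h3
    have h4 : p * L ≤ p * p := Nat.mul_le_mul_left _ (by omega)
    nlinarith
  rcases Nat.eq_zero_or_pos c with hc0 | hcpos
  · -- `p ∣ N`
    obtain ⟨M, hM⟩ : ∃ M, L = M + 2 := ⟨L - 2, by omega⟩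
    have hm2 : m + 2 = p * (M + 2) := by rw [← hM]; omega
    have e0 : p * (M + 2) = p * M + p * 2 := by ring
    by_cases hMp : p ≤ M
    · refine key (q := p - 1) (n := 0) (M := M) (by omega) (by omega) hMp (goodN_zero ?_)
      apply ih M
      · have : 2 * M ≤ p * M := Nat.mul_le_mul_right _ hp
        omega
      · intro hfam
        apply hF
        rw [hm2]
        exact fam_mul hp hfam (by nlinarith)
    · -- `L = p + 1`
      exfalso
      have : L = p + 1 := by omega
      rw [this] at hd
      nlinarith
  · obtain ⟨M, hM⟩ : ∃ M, L = M + 1 := ⟨L - 1, by omega⟩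
    have e0 : p * (M + 1) = p * M + p := by ring
    rw [hM] at hd
    refine key (q := c - 1) (n := p - c) (M := M) (by omega) (by omega) (by omega) ?_
    by_cases hL2 : L < 2 * p
    · obtain ⟨i, hi⟩ : ∃ i, L = p + i := ⟨L - p, by omega⟩
      have hci : c ≤ i := by
        by_contra hcon
        apply hF
        right; right; right
        refine ⟨i, c - 1, 0, by omega, by omega, by omega, ?_⟩
        have : p * (M + 1) = p ^ 2 + i * p := by rw [← hM, hi]; ring
        rw [pow_zero, mul_one]
        omega
      have hB := goodN_mono (by omega) (goodN_B (p := p) (i := i) (by omega) (by omega)) (i - c)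
      have e1 : p + i - 1 = M := by omega
      have e2 : p - i + (i - c) = p - c := by omega
      rwa [e1, e2] at hB
    · have e2 : p - c = 1 + (p - c - 1) := by omega
      rw [e2]
      refine goodN_mono (by omega) ?_ _
      by_cases hdv : ((M + 1 : ℕ) : ZMod p) = 0
      swap
      · exact goodN_one hdv (by omega)
      rw [ZMod.natCast_eq_zero_iff] at hdv
      obtain ⟨t, w, hw, hLw⟩ := Nat.exists_eq_pow_mul_and_not_dvd (n := M + 1) (by omega) p (by omega)
      have ht : 1 ≤ t := by
        rcases Nat.eq_zero_or_pos t with rfl | h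
        · rw [hLw, pow_zero, one_mul] at hdv; exact absurd hdv hw
        · exact h
      have hwd := Nat.mod_add_div w p
      have hwl := Nat.mod_lt w (show 0 < p by omega)
      have hw0 : 1 ≤ w % p := by
        by_contra h
        exact hw (Nat.dvd_of_mod_eq_zero (by omega))
      set d := w % p with hddef
      rcases hh : w / p with _ | h
      · exfalso
        rw [hh, mul_zero, add_zero] at hwd
        rw [← hwd] at hLw
        apply hF
        right; right; left
        by_cases hd1 : d = 1
        · rw [hd1, mul_one] at hLw
          have ht2 : 2 ≤ t := by
            by_contra hcon
            have : t = 1 := by omega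
            rw [this, pow_one] at hLw
            omega
          refine ⟨p - 1, c - 1, t, 0, by omega, le_rfl, by omega, ht2, ?_⟩
          rw [Nat.sub_add_cancel (by omega), pow_zero, mul_one, ← hLw]
          omega
        · refine ⟨d - 1, c - 1, t + 1, 0, by omega, by omega, by omega, by omega, ?_⟩
          rw [Nat.sub_add_cancel (by omega), pow_zero, mul_one]
          have : d * p ^ (t + 1) = p * (M + 1) := by rw [hLw]; ring
          omega
      · rw [hh] at hwd
        exact goodN_C ht hw0 hwl (by rw [hwd]; exact hLw)

/-- monomials in two variables -/
noncomputable def mono (p a b : ℕ) : MvPolynomial (Fin 2) (ZMod p) := X 0 ^ a * X 1 ^ b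

lemma coeff_aux {R : Type*} [CommRing R] (x : R) (r a s : ℕ) :
    ((Polynomial.C x + Polynomial.C (x ^ (r + 1)) * Polynomial.X) ^ a).coeff s
      = (a.choose s : R) * x ^ (a + s * r) := by
  have : (Polynomial.C x + Polynomial.C (x ^ (r + 1)) * Polynomial.X)
      = Polynomial.C x * (1 + Polynomial.C (x ^ r) * Polynomial.X) := by
    rw [mul_add, mul_one, ← mul_assoc, ← Polynomial.C_mul, pow_succ, mul_comm (x ^ r)]
  rw [this, mul_pow, ← Polynomial.C_pow, Polynomial.coeff_C_mul]
  have h2 : ((1 + Polynomial.C (x ^ r) * Polynomial.X) ^ a : Polynomial R)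
      = ((1 + Polynomial.X) ^ a : Polynomial R).comp (Polynomial.C (x ^ r) * Polynomial.X) := by
    simp
  rw [h2, Polynomial.comp_C_mul_X_coeff, Polynomial.coeff_one_add_X_pow]
  ring

lemma steenrod_mono {p : ℕ} (hp : 1 ≤ p) (k a b : ℕ) :
    steenrodP p 2 k (mono p a b) = ∑ x ∈ antidiagonal k,
      ((a.choose x.1 : ZMod p) * (b.choose x.2 : ZMod p)) •
        mono p (a + x.1 * (p - 1)) (b + x.2 * (p - 1)) := by
  obtain ⟨r, rfl⟩ : ∃ r, p = r + 1 := ⟨p - 1, by omega⟩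
  unfold steenrodP Phi mono
  simp only [map_mul, map_pow, aeval_X]
  rw [Polynomial.coeff_mul]
  refine Finset.sum_congr rfl fun x _ => ?_
  simp only [← map_pow]
  rw [coeff_aux, coeff_aux, MvPolynomial.smul_eq_C_mul]
  simp
  ring

lemma mono_hit {p : ℕ} [Fact p.Prime] (m : ℕ) (h : Good p m) (a b : ℕ) (hab : a + b = m) :
    mono p a b ∈ Hit p 2 := by
  by_contra hcon
  obtain ⟨f, hf, hle⟩ := Submodule.exists_le_ker_of_notMem hcon
  apply hf
  refine h (fun a b => f (mono p a b)) ?_ a b hab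
  intro k a b hk _
  have h1 : f (steenrodP p 2 k (mono p a b)) = 0 :=
    hle (Submodule.subset_span ⟨k, hk, _, rfl⟩)
  rw [steenrod_mono (Fact.out : p.Prime).one_le, map_sum] at h1
  simpa only [map_smul, smul_eq_mul] using h1

end Helpers

/-- Vanishing in the remaining degrees (Statement 1.2): if `m` is in none of the degree
families of Crossley's Table 1, then every homogeneous polynomial of total degree `m` in
`P₂ = 𝔽_p[x,y]` is hit, i.e. the degree-`m` part of the quotient by the hit polynomials is
zero. -/
theorem vanishing_remaining_degrees (p : ℕ) (hp : p.Prime) (hodd : Odd p) (m : ℕ)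
    (hma : ¬ m ≤ p - 2)
    (hmb : ¬ ∃ i j s, i ≤ p - 1 ∧ j ≤ p - 1 ∧ m = ((i + 1) * p + j + 1) * p ^ s - 2)
    (hmc : ¬ ∃ i j r s, 1 ≤ i ∧ i ≤ p - 1 ∧ j ≤ p - 2 ∧ 2 ≤ r ∧
        m = ((i + 1) * p ^ r + j + 1) * p ^ s - 2)
    (hmd : ¬ ∃ i j s, 1 ≤ i ∧ i ≤ j ∧ j ≤ p - 2 ∧ m = (p ^ 2 + i * p + j + 1) * p ^ s - 2) :
    ∀ f : MvPolynomial (Fin 2) (ZMod p), f.IsHomogeneous m → f ∈ Hit p 2 := by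
  have : Fact p.Prime := ⟨hp⟩
  have hp2 : 2 ≤ p := hp.two_le
  have hF : ¬ Fam p (m + 2) := by
    rintro (h | ⟨i, j, s, h1, h2, h3⟩ | ⟨i, j, r, s, h1, h2, h3, h4, h5⟩ |
      ⟨i, j, s, h1, h2, h3, h4⟩)
    · exact hma (by omega)
    · exact hmb ⟨i, j, s, h1, h2, by omega⟩
    · exact hmc ⟨i, j, r, s, h1, h2, h3, h4, by omega⟩
    · exact hmd ⟨i, j, s, h1, h2, h3, by omega⟩
  have hG := good_of_not_fam m hF
  intro f hf
  rw [f.as_sum]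
  refine Submodule.sum_mem _ fun d hd => ?_
  have hdeg := hf (mem_support_iff.1 hd)
  have hdm : d 0 + d 1 = m := by
    rw [← hdeg, Finsupp.weight_apply, Finsupp.sum_fintype _ _ (by simp)]
    simp
  have e : monomial d (coeff d f) = coeff d f • mono p (d 0) (d 1) := by
    rw [monomial_eq, Finsupp.prod_fintype _ _ (by simp), MvPolynomial.smul_eq_C_mul]
    simp [mono]
  rw [e]
  exact Submodule.smul_mem _ _ (mono_hit m hG _ _ hdm)
end

section
/- Crossley's Lemma 2.1: Let p be an odd prime. If g ∈ P_2 = 𝔽_p[x,y] is hit, then the polynomial x^{p−1} y^{p−1} g^p is also hit. -/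
open MvPolynomial

lemma coeff_lin_pow {R : Type*} [CommRing R] (a b : R) (n i : ℕ) :
    ((Polynomial.C a + Polynomial.C b * Polynomial.X) ^ n).coeff i
      = a ^ (n - i) * b ^ i * (n.choose i : R) := by
  rw [add_comm, add_pow, Polynomial.finsetSum_coeff]
  have h : ∀ k ∈ Finset.range (n + 1),
      ((Polynomial.C b * Polynomial.X) ^ k * Polynomial.C a ^ (n - k) *
        ((n.choose k : ℕ) : Polynomial R)).coeff i
      = if k = i then a ^ (n - i) * b ^ i * (n.choose i : R) else 0 := by
    intro k _
    have : (Polynomial.C b * Polynomial.X) ^ k * Polynomial.C a ^ (n - k) *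
        ((n.choose k : ℕ) : Polynomial R)
        = Polynomial.C (a ^ (n - k) * b ^ k * (n.choose k : R)) * Polynomial.X ^ k := by
      simp only [map_mul, map_pow, map_natCast]
      ring
    rw [this, Polynomial.coeff_C_mul_X_pow]
    by_cases hk : k = i
    · subst hk; simp
    · rw [if_neg hk, if_neg (Ne.symm hk)]
  rw [Finset.sum_congr rfl h, Finset.sum_ite_eq']
  split_ifs with hi
  · rfl
  · rw [Nat.choose_eq_zero_of_lt (by simpa using hi)]
    simp

lemma coeff_pow_char {R : Type*} [CommRing R] (p : ℕ) (hp : p.Prime) [CharP R p]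
    (f : Polynomial R) (n : ℕ) :
    (f ^ p).coeff n = if p ∣ n then (f.coeff (n / p)) ^ p else 0 := by
  have := Fact.mk hp
  have : ExpChar R p := ExpChar.prime hp
  rw [← Polynomial.map_frobenius_expand, Polynomial.coeff_map, Polynomial.coeff_expand hp.pos]
  split_ifs
  · rfl
  · simp

lemma Phi_mono (p a b : ℕ) :
    Phi p 2 (X 0 ^ a * X 1 ^ b) =
      (Polynomial.C (X 0) + Polynomial.C (X 0 ^ p) * Polynomial.X) ^ a *
      (Polynomial.C (X 1) + Polynomial.C (X 1 ^ p) * Polynomial.X) ^ b := by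
  simp only [Phi, map_mul, map_pow, aeval_X]

lemma Phi_coeff_zero (p h : ℕ) (f : MvPolynomial (Fin h) (ZMod p)) :
    (Phi p h f).coeff 0 = f := by
  have : (Polynomial.constantCoeff (R := MvPolynomial (Fin h) (ZMod p))).comp
      (Phi p h).toRingHom = RingHom.id _ := by
    apply MvPolynomial.ringHom_ext
    · intro r
      have : Phi p h (C r) = Polynomial.C (C r) := by
        rw [← MvPolynomial.algebraMap_eq, AlgHom.commutes]; rfl
      simp [this]
    · intro i
      simp [Phi]
  exact congrArg (fun F => F f) this

lemma hit_mem (p k : ℕ) (hk : 1 ≤ k) (u : MvPolynomial (Fin 2) (ZMod p)) :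
    (Phi p 2 u).coeff k ∈ Hit p 2 :=
  Submodule.subset_span ⟨k, hk, u, rfl⟩

lemma P1_mul_pow (p : ℕ) (hp : p.Prime) (w v : MvPolynomial (Fin 2) (ZMod p)) :
    (Phi p 2 (w * v ^ p)).coeff 1 = (Phi p 2 w).coeff 1 * v ^ p := by
  have h1 : ¬ p ∣ 1 := fun h => hp.one_lt.ne' (Nat.dvd_one.mp h)
  rw [map_mul, map_pow, Polynomial.coeff_mul, Finset.Nat.antidiagonal_succ]
  simp [coeff_pow_char p hp, Phi_coeff_zero, h1]

lemma P1_mono (q s t : ℕ) (hq : 1 ≤ q) (hs : 1 ≤ s) (ht : 1 ≤ t) :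
    (Phi (q+1) 2 (X 0 ^ (q * s) * X 1 ^ (q * t))).coeff 1 =
      ((q * s : ℕ) : MvPolynomial (Fin 2) (ZMod (q+1))) * (X 0 ^ (q * (s+1)) * X 1 ^ (q * t))
      + ((q * t : ℕ) : MvPolynomial (Fin 2) (ZMod (q+1))) *
        (X 0 ^ (q * s) * X 1 ^ (q * (t+1))) := by
  rw [Phi_mono, Polynomial.mul_coeff_one]
  have aux : ∀ (r : ℕ) (z : MvPolynomial (Fin 2) (ZMod (q+1))), 1 ≤ r →
      z ^ (q * r - 1) * z ^ (q + 1) = z ^ (q * (r + 1)) := by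
    intro r z hr
    rw [← pow_add]
    congr 1
    have : 1 ≤ q * r := Nat.mul_pos hq hr
    rw [mul_add]; omega
  simp only [coeff_lin_pow, pow_one, pow_zero,
    Nat.choose_zero_right, Nat.choose_one_right, Nat.sub_zero,
    Nat.cast_one, mul_one, aux s _ hs, aux t _ ht]
  ring

/-- Monomials `e_s` times p-th powers are hit. -/
lemma e_hit (q : ℕ) (hp : (q+1).Prime) (v : MvPolynomial (Fin 2) (ZMod (q+1))) (i : ℕ) :
    i + 1 ≤ q → (X 0 ^ (q * (i+2)) * X 1 ^ (q * (q+1-i))) * v ^ (q+1) ∈ Hit (q+1) 2 := by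
  have := Fact.mk hp
  intro hi
  have hq : 1 ≤ q := by omega
  have key : ∀ s t : ℕ, 1 ≤ s → s ≤ q → 1 ≤ t →
      ((t : ZMod (q+1)) • ((X 0 ^ (q * s) * X 1 ^ (q * (t+1))) * v ^ (q+1)) ∈ Hit (q+1) 2) →
      (X 0 ^ (q * (s+1)) * X 1 ^ (q * t)) * v ^ (q+1) ∈ Hit (q+1) 2 := by
    intro s t hs hsq ht h
    have h1 := hit_mem (q+1) 1 le_rfl ((X 0 ^ (q * s) * X 1 ^ (q * t)) * v ^ (q+1))
    rw [P1_mul_pow _ hp, P1_mono q s t hq hs ht] at h1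
    have h2 := Submodule.smul_mem _ (q : ZMod (q+1)) h
    have h3 := Submodule.sub_mem _ h1 h2
    have h4 : ((q * s : ℕ) : ZMod (q+1)) ≠ 0 := by
      intro h0
      rw [ZMod.natCast_eq_zero_iff] at h0
      rcases hp.dvd_mul.mp h0 with h0 | h0
      · have := Nat.le_of_dvd (by omega) h0; omega
      · have := Nat.le_of_dvd (by omega) h0; omega
    have h5 := Submodule.smul_mem _ (((q * s : ℕ) : ZMod (q+1))⁻¹) h3
    convert h5 using 1
    rw [eq_inv_smul_iff₀ h4]
    simp only [MvPolynomial.smul_eq_C_mul, map_natCast]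
    push_cast
    ring
  induction i with
  | zero =>
    refine key 1 (q+1) le_rfl hq (by omega) ?_
    rw [ZMod.natCast_self, zero_smul]
    exact Submodule.zero_mem _
  | succ i ih =>
    have ih' := ih (by omega)
    refine key (i+2) (q+1-(i+1)) (by omega) (by omega) (by omega) ?_
    apply Submodule.smul_mem
    convert ih' using 5
    omega

lemma Pp_hit (q : ℕ) (hp : (q+1).Prime) (v : MvPolynomial (Fin 2) (ZMod (q+1))) :
    (Phi (q+1) 2 (X 0 ^ q * X 1 ^ q)).coeff (q+1) * v ^ (q+1) ∈ Hit (q+1) 2 := by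
  rw [Phi_mono, Polynomial.coeff_mul, Finset.sum_mul]
  apply Submodule.sum_mem
  rintro ⟨i, j⟩ hij
  rw [Finset.HasAntidiagonal.mem_antidiagonal] at hij
  simp only at hij
  simp only [coeff_lin_pow]
  by_cases hi : q < i
  · rw [Nat.choose_eq_zero_of_lt hi]; simp
  by_cases hj : q < j
  · rw [Nat.choose_eq_zero_of_lt hj]; simp
  obtain ⟨a, rfl⟩ : ∃ a, i = a + 1 := ⟨i - 1, by omega⟩
  have h := Submodule.smul_mem _
    ((q.choose (a+1) * q.choose j : ℕ) : ZMod (q+1)) (e_hit q hp v a (by omega))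
  convert h using 1
  have aux : ∀ (r : ℕ) (z : MvPolynomial (Fin 2) (ZMod (q+1))), r ≤ q →
      z ^ (q - r) * (z ^ (q + 1)) ^ r = z ^ (q * (r + 1)) := by
    intro r z hr
    rw [← pow_mul, ← pow_add]
    congr 1
    zify [hr]; ring
  rw [aux _ _ (by omega), aux _ _ (by omega), show q + 1 - a = j + 1 by omega]
  simp only [MvPolynomial.smul_eq_C_mul, map_natCast]
  push_cast
  ring

lemma main_gen (q : ℕ) (hp : (q+1).Prime) (k : ℕ) (hk : 1 ≤ k)
    (u : MvPolynomial (Fin 2) (ZMod (q+1))) :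
    X 0 ^ q * X 1 ^ q * ((Phi (q+1) 2 u).coeff k) ^ (q+1) ∈ Hit (q+1) 2 := by
  obtain ⟨k, rfl⟩ : ∃ l, k = l + 1 := ⟨k - 1, by omega⟩
  have hz : ∀ n, 2 * q < n → (Phi (q+1) 2 (X 0 ^ q * X 1 ^ q)).coeff n = 0 := by
    intro n hn
    rw [Phi_mono, Polynomial.coeff_mul]
    apply Finset.sum_eq_zero
    rintro ⟨i, j⟩ hij
    rw [Finset.HasAntidiagonal.mem_antidiagonal] at hij
    simp only at hij
    simp only [coeff_lin_pow]
    by_cases hi : q < i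
    · rw [Nat.choose_eq_zero_of_lt hi]; simp
    · rw [Nat.choose_eq_zero_of_lt (show q < j by omega)]; simp
  have h1 := hit_mem (q+1) ((q+1) * (k+1)) (by nlinarith) (X 0 ^ q * X 1 ^ q * u ^ (q+1))
  have h2 := Pp_hit q hp ((Phi (q+1) 2 u).coeff k)
  have h3 := Submodule.sub_mem _ h1 h2
  convert h3 using 1
  rw [eq_sub_iff_add_eq, map_mul (Phi (q+1) 2) (X 0 ^ q * X 1 ^ q) (u ^ (q+1)),
    map_pow (Phi (q+1) 2) u]
  set F := Phi (q+1) 2 (X 0 ^ q * X 1 ^ q) with hF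
  have hF0 : F.coeff 0 = X 0 ^ q * X 1 ^ q := Phi_coeff_zero _ _ _
  have hne : ((0, (q+1)*(k+1)) : ℕ × ℕ) ≠ (q+1, (q+1)*k) := by
    intro h; simp at h
  rw [Polynomial.coeff_mul F, ← Finset.sum_subset (s₁ := {(0, (q+1)*(k+1)), (q+1, (q+1)*k)})]
  · rw [Finset.sum_pair hne]
    simp only [coeff_pow_char (q+1) hp, hF0, dvd_mul_right, if_true,
      Nat.mul_div_cancel_left _ (Nat.succ_pos q)]
  · intro x hx
    simp only [Finset.mem_insert, Finset.mem_singleton] at hx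
    rw [Finset.HasAntidiagonal.mem_antidiagonal]
    rcases hx with rfl | rfl
    · simp
    · simp only; ring
  · rintro ⟨i, j⟩ hij hn
    rw [Finset.HasAntidiagonal.mem_antidiagonal] at hij
    simp only at hij
    simp only [Finset.mem_insert, Finset.mem_singleton, Prod.mk.injEq, not_or, not_and] at hn
    simp only [coeff_pow_char (q+1) hp]
    split_ifs with hd
    · by_cases hi : 2 * q < i
      · rw [hz i hi, zero_mul]
      exfalso
      have hdi : (q+1) ∣ i := by
        have : (q+1) ∣ i + j := by rw [hij]; exact dvd_mul_right _ _
        exact (Nat.dvd_add_left hd).mp this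
      obtain ⟨c, rfl⟩ := hdi
      have hc : c < 2 := by
        by_contra hc
        have : 2 ≤ c := by omega
        nlinarith
      interval_cases c
      · exact hn.1 (by simp) (by omega)
      · exact hn.2 (by simp) (by rw [mul_add] at hij; omega)
    · rw [mul_zero]

/-- Crossley's Lemma 2.1: if `g ∈ P₂ = 𝔽_p[x,y]` is hit, then `x^{p-1} y^{p-1} g^p`
is also hit. -/
theorem crossley_lemma (p : ℕ) (hp : p.Prime) (hodd : Odd p)
    (g : MvPolynomial (Fin 2) (ZMod p)) (hg : g ∈ Hit p 2) :
    X 0 ^ (p - 1) * X 1 ^ (p - 1) * g ^ p ∈ Hit p 2 := by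
  obtain ⟨q, rfl⟩ : ∃ q, p = q + 1 := ⟨p - 1, by have := hp.pos; omega⟩
  have := Fact.mk hp
  simp only [Nat.add_sub_cancel]
  unfold Hit at hg
  induction hg using Submodule.span_induction with
  | mem x hx =>
    obtain ⟨k, hk, u, rfl⟩ := hx
    exact main_gen q hp k hk u
  | zero => simp
  | add x y _ _ hx hy =>
    rw [add_pow_char, mul_add]
    exact Submodule.add_mem _ hx hy
  | smul a x _ hx =>
    rw [smul_pow, mul_smul_comm]
    exact Submodule.smul_mem _ _ hx
end
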